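/- Let G be a unicyclic graph of order n whose unique cycle has length k with k ≡ 1 (mod 4). Then s⁺(G) < n < s⁻(G). -/

import Mathlib

variable {V : Type*}

/-- Number of matchings of size `j` in `H` (sets of `j` pairwise vertex-disjoint edges). -/
noncomputable def mcount (H : SimpleGraph V) (j : ℕ) : ℕ :=
  Set.ncard {M : Finset (Sym2 V) | (∀ e ∈ M, e ∈ H.edgeSet) ∧ M.card = j ∧
    ∀ e ∈ M, ∀ f ∈ M, e ≠ f → ∀ v : V, ¬(v ∈ e ∧ v ∈ f)}

/-- The matching polynomial of `H`, as a function on `ℂ`. -/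
noncomputable def matchPolyFun [Fintype V] (H : SimpleGraph V) (x : ℂ) : ℂ :=
  ∑ j ∈ Finset.range (Fintype.card V / 2 + 1),
    (-1 : ℂ) ^ j * (mcount H j : ℂ) * x ^ (Fintype.card V - 2 * j)

/-- The characteristic polynomial `det (x • 1 - A(G))` of the adjacency matrix, as a function. -/
noncomputable def charFun [Fintype V] [DecidableEq V] (G : SimpleGraph V)
    [DecidableRel G.Adj] (x : ℂ) : ℂ :=
  (x • (1 : Matrix V V ℂ) - G.adjMatrix ℂ).det

/-- The adjacency matrix of a graph is Hermitian (symmetric). -/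
theorem adjHerm [Fintype V] [DecidableEq V] (G : SimpleGraph V) [DecidableRel G.Adj] :
    (G.adjMatrix ℝ).IsHermitian := by
  rw [Matrix.IsHermitian, Matrix.conjTranspose_eq_transpose_of_trivial]
  exact SimpleGraph.isSymm_adjMatrix G

/-- Positive square energy. -/
noncomputable def sPlus [Fintype V] [DecidableEq V] (G : SimpleGraph V) [DecidableRel G.Adj] : ℝ :=
  ∑ i, if 0 < (adjHerm G).eigenvalues i then ((adjHerm G).eigenvalues i) ^ 2 else 0

/-- Negative square energy. -/
noncomputable def sMinus [Fintype V] [DecidableEq V] (G : SimpleGraph V) [DecidableRel G.Adj] : ℝ :=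
  ∑ i, if (adjHerm G).eigenvalues i < 0 then ((adjHerm G).eigenvalues i) ^ 2 else 0

open Complex in
theorem aux_prod_polar {ι : Type*} [Fintype ι] (l : ι → ℝ) (x : ℝ) (hx : 0 < x) :
    (∏ i, ((x:ℂ) + l i * I)).im
      = (∏ i, Real.sqrt (x ^ 2 + l i ^ 2)) * Real.sin (∑ i, Real.arctan (l i / x)) := by
  have h : ∀ i, ((x:ℂ) + l i * I)
      = ((Real.sqrt (x ^ 2 + l i ^ 2) : ℝ) : ℂ) * exp ((Real.arctan (l i / x) : ℝ) * I) := by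
    intro i
    have hs : Real.sqrt (1 + (l i / x) ^ 2) = Real.sqrt (x ^ 2 + l i ^ 2) / x := by
      rw [show 1 + (l i / x) ^ 2 = (x ^ 2 + l i ^ 2) / x ^ 2 by field_simp,
        Real.sqrt_div (by positivity), Real.sqrt_sq hx.le]
    have hpos : 0 < Real.sqrt (x ^ 2 + l i ^ 2) := by positivity
    rw [exp_mul_I, ← ofReal_cos, ← ofReal_sin, Real.cos_arctan, Real.sin_arctan, hs]
    have e1 : Real.sqrt (x ^ 2 + l i ^ 2) * (1 / (Real.sqrt (x ^ 2 + l i ^ 2) / x)) = x := by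
      field_simp
    have e2 : Real.sqrt (x ^ 2 + l i ^ 2) * (l i / x / (Real.sqrt (x ^ 2 + l i ^ 2) / x)) = l i := by
      field_simp
    rw [mul_add, ← mul_assoc, ← ofReal_mul, ← ofReal_mul, e1, e2]
  rw [Finset.prod_congr rfl (fun i _ => h i), Finset.prod_mul_distrib, ← exp_sum,
    ← Finset.sum_mul, ← ofReal_sum, ← ofReal_prod, im_ofReal_mul, exp_ofReal_mul_I_im]

open Filter Topology in
theorem aux_theta_pos {ι : Type*} [Fintype ι] (l : ι → ℝ)
    (him : ∀ x : ℝ, 0 < x → 0 < (∏ i, ((x:ℂ) + l i * Complex.I)).im) (x : ℝ) (hx : 0 < x) :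
    0 < ∑ i, Real.arctan (l i / x) := by
  have hsin : ∀ y : ℝ, 0 < y → 0 < Real.sin (∑ i, Real.arctan (l i / y)) := by
    intro y hy
    have := him y hy
    rw [aux_prod_polar l y hy] at this
    exact pos_of_mul_pos_right this (Finset.prod_nonneg fun i _ => Real.sqrt_nonneg _)
  have hlim : Tendsto (fun y : ℝ => ∑ i, Real.arctan (l i / y)) atTop (𝓝 0) := by
    have : Tendsto (fun y : ℝ => ∑ i, Real.arctan (l i / y)) atTop (𝓝 (∑ i : ι, Real.arctan 0)) :=
      tendsto_finsetSum _ fun i _ =>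
        (Real.continuous_arctan.tendsto 0).comp (tendsto_const_nhds.div_atTop tendsto_id)
    simpa using this
  by_contra! hneg
  obtain ⟨y, hy1, hy2⟩ := ((hlim.eventually (Ioo_mem_nhds (neg_lt_zero.2 Real.pi_pos)
    Real.pi_pos)).and (eventually_ge_atTop x)).exists
  have hy0 : 0 < y := hx.trans_le hy2
  have hypos : 0 ≤ ∑ i, Real.arctan (l i / y) := by
    by_contra! h
    exact absurd (hsin y hy0) (not_lt.2 (Real.sin_nonpos_of_nonpos_of_neg_pi_le h.le hy1.1.le))
  have hcont : ContinuousOn (fun y : ℝ => ∑ i, Real.arctan (l i / y)) (Set.Icc x y) := by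
    refine continuousOn_finsetSum _ fun i _ => Real.continuous_arctan.comp_continuousOn ?_
    exact continuousOn_const.div continuousOn_id fun z hz => (hx.trans_le hz.1).ne'
  obtain ⟨z, hz, hz0⟩ := intermediate_value_Icc hy2 hcont ⟨hneg, hypos⟩
  have := hsin z (hx.trans_le hz.1)
  simp only at hz0
  rw [hz0] at this
  simp at this

theorem aux_arctan_bounds (u : ℝ) (hu : 0 ≤ u) :
    u ≤ (1 + u ^ 2) * Real.arctan u ∧ Real.arctan u ≤ u := by
  have hmono : MonotoneOn (fun u : ℝ => (1 + u ^ 2) * Real.arctan u - u) (Set.Ici 0) := by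
    apply monotoneOn_of_deriv_nonneg (convex_Ici 0)
    · have := Real.continuous_arctan
      fun_prop
    · have := Real.differentiable_arctan
      fun_prop
    · intro z hz
      have hz : 0 < z := by simpa using hz
      have h := (((((hasDerivAt_id z).pow 2).const_add 1).mul (Real.hasDerivAt_arctan z)).sub
        (hasDerivAt_id z))
      have h2 := h.deriv
      have : deriv (fun u : ℝ => (1 + u ^ 2) * Real.arctan u - u) z
         = 2 * z * Real.arctan z := by
        refine Eq.trans h2 ?_
        simp
        field_simp
        ring
      rw [this]
      have := Real.arctan_nonneg.2 hz.le
      positivity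
  have hmono2 : MonotoneOn (fun u : ℝ => u - Real.arctan u) (Set.Ici 0) := by
    apply monotoneOn_of_deriv_nonneg (convex_Ici 0)
    · have := Real.continuous_arctan
      fun_prop
    · have := Real.differentiable_arctan
      fun_prop
    · intro z hz
      have h2 := ((hasDerivAt_id z).sub (Real.hasDerivAt_arctan z)).deriv
      have : deriv (fun u : ℝ => u - Real.arctan u) z = 1 - 1 / (1 + z ^ 2) := h2
      rw [this, sub_nonneg, div_le_one (by positivity)]
      nlinarith [sq_nonneg z]
  have h1 := hmono (Set.mem_Ici.2 le_rfl) (Set.mem_Ici.2 hu) hu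
  have h2 := hmono2 (Set.mem_Ici.2 le_rfl) (Set.mem_Ici.2 hu) hu
  simp at h1 h2
  exact ⟨h1, h2⟩

theorem aux_bound (a x : ℝ) (hx : 0 < x) :
    |(x ^ 2 + a ^ 2) * Real.arctan (a / x) - a * x| ≤ |a| ^ 3 / x := by
  have key : ∀ a : ℝ, 0 ≤ a → |(x ^ 2 + a ^ 2) * Real.arctan (a / x) - a * x| ≤ a ^ 3 / x := by
    intro a ha
    obtain ⟨h1, h2⟩ := aux_arctan_bounds (a / x) (by positivity)
    have e : (x ^ 2 + a ^ 2) = x ^ 2 * (1 + (a / x) ^ 2) := by field_simp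
    rw [abs_of_nonneg]
    · have := mul_le_mul_of_nonneg_left h2 (show 0 ≤ x ^ 2 + a ^ 2 by positivity)
      have e2 : (x ^ 2 + a ^ 2) * (a / x) = a * x + a ^ 3 / x := by field_simp
      linarith
    · rw [e]
      have := mul_le_mul_of_nonneg_left h1 (show 0 ≤ x ^ 2 by positivity)
      have e2 : x ^ 2 * (a / x) = a * x := by field_simp
      linarith
  rcases le_total 0 a with ha | ha
  · rw [abs_of_nonneg ha]; exact key a ha
  · have := key (-a) (by linarith)
    rw [abs_of_nonpos ha, neg_div, Real.arctan_neg, neg_sq] at *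
    rw [← abs_neg]
    convert this using 2
    ring

open Filter Topology in
theorem aux_energy {ι : Type*} [Fintype ι] (l : ι → ℝ) (hsum : ∑ i, l i = 0)
    (him : ∀ x : ℝ, 0 < x → 0 < (∏ i, ((x:ℂ) + l i * Complex.I)).im) :
    ∑ i, l i * |l i| < 0 := by
  set H : ℝ → ℝ := fun x => ∑ i, (x ^ 2 + l i ^ 2) * Real.arctan (l i / x) with hH
  have hder : ∀ x : ℝ, 0 < x → HasDerivAt H (2 * x * ∑ i, Real.arctan (l i / x)) x := by
    intro x hx
    have h1 : HasDerivAt H (∑ i, (2 * x * Real.arctan (l i / x) - l i)) x := by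
      apply HasDerivAt.fun_sum
      intro i _
      have h := (((hasDerivAt_id x).pow 2).add_const (l i ^ 2)).mul
        (((hasDerivAt_const x (l i)).div (hasDerivAt_id x) hx.ne').arctan)
      refine h.congr_deriv ?_
      simp
      have : x ^ 2 + l i ^ 2 ≠ 0 := by positivity
      field_simp
      ring
    refine h1.congr_deriv ?_
    rw [Finset.sum_sub_distrib, hsum, Finset.mul_sum, sub_zero]
  have hmono : StrictMonoOn H (Set.Ioi 0) := by
    apply strictMonoOn_of_deriv_pos (convex_Ioi 0)
    · exact fun x hx => (hder x hx).continuousAt.continuousWithinAt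
    · intro x hx
      rw [interior_Ioi] at hx
      have hx : 0 < x := hx
      rw [(hder x hx).deriv]
      have := aux_theta_pos l him x hx
      positivity
  have htop : Tendsto H atTop (𝓝 0) := by
    have hb : ∀ᶠ x in atTop, ‖H x‖ ≤ (∑ i, |l i| ^ 3) / x := by
      filter_upwards [eventually_gt_atTop 0] with x hx
      have : H x = ∑ i, ((x ^ 2 + l i ^ 2) * Real.arctan (l i / x) - l i * x) := by
        rw [Finset.sum_sub_distrib, ← Finset.sum_mul, hsum]; simp [hH]
      rw [this, Real.norm_eq_abs, Finset.sum_div]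
      exact (Finset.abs_sum_le_sum_abs _ _).trans
        (Finset.sum_le_sum fun i _ => aux_bound (l i) x hx)
    exact squeeze_zero_norm' hb (tendsto_const_nhds.div_atTop tendsto_id)
  have hzero : Tendsto H (𝓝[>] 0) (𝓝 (∑ i, (Real.pi / 2) * (l i * |l i|))) := by
    apply tendsto_finsetSum
    intro i _
    have hp : Tendsto (fun x : ℝ => x ^ 2 + l i ^ 2) (𝓝[>] 0) (𝓝 (l i ^ 2)) := by
      have : Continuous (fun x : ℝ => x ^ 2 + l i ^ 2) := by fun_prop
      have := this.tendsto 0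
      simp only [ne_eq, OfNat.ofNat_ne_zero, not_false_eq_true, zero_pow, zero_add] at this
      exact this.mono_left nhdsWithin_le_nhds
    rcases lt_trichotomy (l i) 0 with h | h | h
    · have h2 : Tendsto (fun x : ℝ => l i / x) (𝓝[>] 0) atBot := by
        simp_rw [div_eq_mul_inv]
        exact tendsto_inv_nhdsGT_zero.const_mul_atTop_of_neg h
      have h3 := (Real.tendsto_arctan_atBot.mono_right nhdsWithin_le_nhds).comp h2
      have h4 := hp.mul h3
      have e : Real.pi / 2 * (l i * |l i|) = l i ^ 2 * -(Real.pi / 2) := by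
        rw [abs_of_neg h]; ring
      rw [e]
      exact h4
    · simp [h]
    · have h2 : Tendsto (fun x : ℝ => l i / x) (𝓝[>] 0) atTop := by
        simp_rw [div_eq_mul_inv]
        exact tendsto_inv_nhdsGT_zero.const_mul_atTop h
      have h3 := (Real.tendsto_arctan_atTop.mono_right nhdsWithin_le_nhds).comp h2
      have h4 := hp.mul h3
      have e : Real.pi / 2 * (l i * |l i|) = l i ^ 2 * (Real.pi / 2) := by
        rw [abs_of_pos h]; ring
      rw [e]
      exact h4
  have hle : ∑ i, (Real.pi / 2) * (l i * |l i|) ≤ H 1 := by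
    refine le_of_tendsto hzero ?_
    filter_upwards [Ioo_mem_nhdsGT (show (0:ℝ) < 1 by norm_num)] with x hx
    exact (hmono (Set.mem_Ioi.2 hx.1) (Set.mem_Ioi.2 one_pos) hx.2).le
  have hge : H 2 ≤ 0 := by
    refine ge_of_tendsto htop ?_
    filter_upwards [eventually_gt_atTop 2] with x hx
    exact (hmono (Set.mem_Ioi.2 two_pos) (Set.mem_Ioi.2 (by linarith)) hx).le
  have h12 : H 1 < H 2 := hmono (Set.mem_Ioi.2 one_pos) (Set.mem_Ioi.2 two_pos) (by norm_num)
  rw [← Finset.mul_sum] at hle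
  have hpi := Real.pi_pos
  by_contra! hcon
  have : 0 ≤ Real.pi / 2 * ∑ i, l i * |l i| := by positivity
  linarith


theorem aux_cycle_edges [Fintype V] [DecidableEq V] (G : SimpleGraph V)
    [DecidableRel G.Adj]
    (hconn : G.Connected) (hedge : G.edgeFinset.card = Fintype.card V)
    {u v : V} (c : G.Walk v v) (hc : c.IsCycle) (d : G.Walk u u) (hd : d.IsCycle) :
    c.edges ⊆ d.edges := by
  intro e he
  by_contra hne
  have heG := c.edges_subset_edgeSet he
  have hnb : ¬ G.IsBridge e := fun h => h.notMem_edges_of_isCycle hc he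
  have htree : (G.deleteEdges {e}).IsTree := by
    rw [SimpleGraph.isTree_iff_connected_and_card]
    refine ⟨?_, ?_⟩
    · induction e with
      | _ x y => exact hconn.connected_delete_edge_of_not_isBridge hnb
    · have h1 : Nat.card (G.deleteEdges {e}).edgeSet = (G.edgeFinset.erase e).card := by
        rw [Nat.card_coe_set_eq, ← Set.ncard_coe_finset]
        congr 1
        ext f
        simp [SimpleGraph.edgeSet_deleteEdges, and_comm]
      have h2 : e ∈ G.edgeFinset := by simpa using heG
      have := Finset.card_pos.2 ⟨e, h2⟩
      rw [h1, Finset.card_erase_of_mem h2, Nat.card_eq_fintype_card]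
      omega
  exact htree.isAcyclic _ (hd.toDeleteEdges G {e} (by
    intro f hf hfe
    rw [Set.mem_singleton_iff] at hfe
    exact hne (hfe ▸ hf)))

theorem aux_perm_walk [Fintype V] [DecidableEq V] (G : SimpleGraph V) (τ : Equiv.Perm V)
    (hτ : τ.IsCycle) (hadj : ∀ x ∈ τ.support, G.Adj x (τ x)) (h3 : 3 ≤ τ.support.card) :
    ∃ (u : V) (w : G.Walk u u), w.IsCycle ∧ w.length = τ.support.card ∧
      ∀ y ∈ w.support, y ∈ τ.support := by
  obtain ⟨x, hx, -⟩ := id hτ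
  have hxs : x ∈ τ.support := Equiv.Perm.mem_support.2 hx
  have hpow : ∀ j : ℕ, (τ ^ j) x ∈ τ.support := fun j => by
    rwa [Equiv.Perm.pow_apply_mem_support]
  have hw : ∀ j : ℕ, ∃ p : G.Walk x ((τ ^ j) x),
      p.support = (List.range (j + 1)).map (fun i => (τ ^ i) x) := by
    intro j
    induction j with
    | zero => exact ⟨SimpleGraph.Walk.nil, rfl⟩
    | succ j ih =>
      obtain ⟨p, hp⟩ := ih
      have ha : G.Adj ((τ ^ j) x) ((τ ^ (j + 1)) x) := by
        have := hadj _ (hpow j)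
        rwa [← Equiv.Perm.mul_apply, ← pow_succ'] at this
      refine ⟨p.concat ha, ?_⟩
      rw [SimpleGraph.Walk.support_concat, hp, List.range_succ (n := j + 1)]
      simp
  obtain ⟨N, hN⟩ : ∃ N, τ.support.card = N + 1 := ⟨τ.support.card - 1, by omega⟩
  obtain ⟨p, hp⟩ := hw N
  have hlen : p.length = N := by
    have := congrArg List.length hp
    simpa using this
  have hpath : p.IsPath := by
    rw [SimpleGraph.Walk.isPath_def, hp]
    refine List.Nodup.map_on ?_ List.nodup_range
    intro i hi j hj hij
    rw [List.mem_range, ← hN] at hi hj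
    have : (τ ^ i) = (τ ^ j) := by
      rw [hτ.pow_eq_pow_iff]
      exact ⟨x, hx, hij⟩
    rw [pow_inj_mod, hτ.orderOf, Nat.mod_eq_of_lt hi, Nat.mod_eq_of_lt hj] at this
    exact this
  have hclose : G.Adj ((τ ^ N) x) x := by
    have := hadj _ (hpow N)
    rwa [← Equiv.Perm.mul_apply, ← pow_succ', ← hN, ← hτ.orderOf, pow_orderOf_eq_one,
      Equiv.Perm.one_apply] at this
  refine ⟨_, SimpleGraph.Walk.cons hclose p, ?_, ?_, ?_⟩
  · rw [SimpleGraph.Walk.cons_isCycle_iff]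
    refine ⟨hpath, fun hmem => ?_⟩
    rw [Sym2.eq_swap] at hmem
    have := hpath.length_eq_one_of_mem_edges hmem
    omega
  · simp [hlen, hN]
  · intro y hy
    rw [SimpleGraph.Walk.support_cons, List.mem_cons, hp, List.mem_map] at hy
    rcases hy with rfl | ⟨i, -, rfl⟩
    · exact hpow N
    · exact hpow i

theorem aux_walk_perm [Fintype V] [DecidableEq V] (G : SimpleGraph V) {v : V}
    (c : G.Walk v v) (hc : c.IsCycle) :
    ∃ τ : Equiv.Perm V, τ.IsCycle ∧ τ.support.card = c.length ∧
      ∀ x ∈ τ.support, G.Adj x (τ x) := by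
  have hnd := hc.support_nodup
  have h3 := hc.three_le_length
  have hl : c.support.tail.length = c.length := by simp
  have hne : ∀ x, c.support.tail ≠ [x] := by
    intro x h
    rw [h] at hl
    simp at hl
    omega
  refine ⟨c.support.tail.formPerm, List.isCycle_formPerm hnd (by omega), ?_, ?_⟩
  · rw [List.support_formPerm_of_nodup _ hnd hne, List.toFinset_card_of_nodup hnd, hl]
  · intro x hx
    rw [List.support_formPerm_of_nodup _ hnd hne, List.mem_toFinset] at hx
    obtain ⟨i, hi, rfl⟩ := List.getElem_of_mem hx
    rw [List.formPerm_apply_getElem _ hnd]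
    simp only [List.getElem_tail, SimpleGraph.Walk.support_getElem_eq_getVert]
    rw [hl]
    rw [hl] at hi
    by_cases h : i + 1 < c.length
    · rw [Nat.mod_eq_of_lt h]
      exact c.adj_getVert_succ h
    · have : i + 1 = c.length := by omega
      rw [this, Nat.mod_self, SimpleGraph.Walk.getVert_length]
      have := c.adj_getVert_succ (i := 0) (by omega)
      simpa using this

/-- contribution of a cycle of length `n` -/
noncomputable def cycWeight (n : ℕ) : ℂ := -(-1) ^ n * Complex.I ^ n

theorem cycWeight_two : cycWeight 2 = 1 := by simp [cycWeight]

theorem cycWeight_one_mod (n : ℕ) (h : n % 4 = 1) : cycWeight n = Complex.I := by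
  obtain ⟨m, rfl⟩ : ∃ m, n = 4 * m + 1 := ⟨n / 4, by omega⟩
  have h4 : ((-1 : ℂ) ^ 4) = 1 := by norm_num
  simp [cycWeight, pow_add, pow_mul, h4]

theorem aux_sign [Fintype V] [DecidableEq V] (σ : Equiv.Perm V) :
    ((Equiv.Perm.sign σ : ℤ) : ℂ) * Complex.I ^ σ.support.card
      = ∏ τ ∈ σ.cycleFactorsFinset, cycWeight τ.support.card := by
  have h : ∏ τ ∈ σ.cycleFactorsFinset, cycWeight τ.support.card
      = (σ.cycleType.map cycWeight).prod := by
    rw [Equiv.Perm.cycleType_def, Multiset.map_map]; rfl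
  rw [h, ← Equiv.Perm.sum_cycleType, Equiv.Perm.sign_of_cycleType']
  induction σ.cycleType using Multiset.induction_on with
  | empty => simp
  | cons a s ih =>
    simp only [Multiset.map_cons, Multiset.prod_cons, Multiset.sum_cons, ← ih, pow_add,
      Units.val_mul, Int.cast_mul, cycWeight]
    push_cast
    ring

theorem aux_term [Fintype V] [DecidableEq V] (G : SimpleGraph V) [DecidableRel G.Adj]
    (x : ℝ) (σ : Equiv.Perm V) (hadj : ∀ v ∈ σ.support, G.Adj v (σ v)) :
    Equiv.Perm.sign σ • ∏ v, ((x : ℂ) • (1 : Matrix V V ℂ) + Complex.I • G.adjMatrix ℂ) (σ v) v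
      = ((x ^ (σ.supportᶜ).card : ℝ) : ℂ) *
        ∏ τ ∈ σ.cycleFactorsFinset, cycWeight τ.support.card := by
  rw [← aux_sign, ← Finset.prod_mul_prod_compl σ.support]
  have h1 : ∏ v ∈ σ.support,
      ((x : ℂ) • (1 : Matrix V V ℂ) + Complex.I • G.adjMatrix ℂ) (σ v) v
      = Complex.I ^ σ.support.card := by
    apply Finset.prod_eq_pow_card
    intro v hv
    have ha := hadj v hv
    simp [ha.symm, ha.ne']
  have h2 : ∏ v ∈ σ.supportᶜ,
      ((x : ℂ) • (1 : Matrix V V ℂ) + Complex.I • G.adjMatrix ℂ) (σ v) v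
      = (x : ℂ) ^ (σ.supportᶜ).card := by
    apply Finset.prod_eq_pow_card
    intro v hv
    have : σ v = v := by simpa using hv
    simp [this]
  rw [h1, h2, Units.smul_def, zsmul_eq_mul]
  push_cast
  ring

theorem aux_term_zero [Fintype V] [DecidableEq V] (G : SimpleGraph V) [DecidableRel G.Adj]
    (x : ℝ) (σ : Equiv.Perm V) (hadj : ¬ ∀ v ∈ σ.support, G.Adj v (σ v)) :
    Equiv.Perm.sign σ • ∏ v, ((x : ℂ) • (1 : Matrix V V ℂ) + Complex.I • G.adjMatrix ℂ) (σ v) v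
      = 0 := by
  push Not at hadj
  obtain ⟨v, hv, hna⟩ := hadj
  rw [Finset.prod_eq_zero (Finset.mem_univ v), smul_zero]
  have : σ v ≠ v := by simpa using hv
  simp [this, G.adj_comm, hna]

theorem aux_det_im [Fintype V] [DecidableEq V] (G : SimpleGraph V)
    [DecidableRel G.Adj]
    (hconn : G.Connected) (hedge : G.edgeFinset.card = Fintype.card V)
    (v : V) (c : G.Walk v v) (hc : c.IsCycle) (hk : c.length % 4 = 1) (x : ℝ) (hx : 0 < x) :
    0 < (((x : ℂ) • (1 : Matrix V V ℂ) + Complex.I • G.adjMatrix ℂ).det).im := by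
  rw [Matrix.det_apply, Complex.im_sum]
  have hlen : ∀ (u : V) (d : G.Walk u u), d.IsCycle → d.length = c.length := by
    intro u d hd
    rw [← SimpleGraph.Walk.length_edges, ← SimpleGraph.Walk.length_edges]
    refine le_antisymm ?_ ?_
    · exact (List.subperm_of_subset hd.edges_nodup
        (aux_cycle_edges G hconn hedge d hd c hc)).length_le
    · exact (List.subperm_of_subset hc.edges_nodup
        (aux_cycle_edges G hconn hedge c hc d hd)).length_le
  apply Finset.sum_pos'
  · intro σ _
    by_cases hadj : ∀ v ∈ σ.support, G.Adj v (σ v)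
    · rw [aux_term G x σ hadj, Complex.im_ofReal_mul]
      refine mul_nonneg (by positivity) ?_
      have hcyc : ∀ τ ∈ σ.cycleFactorsFinset, τ.support.card ≠ 2 →
          ∃ (u : V) (w : G.Walk u u), w.IsCycle ∧ w.length = τ.support.card ∧
            ∀ y ∈ w.support, y ∈ τ.support := by
        intro τ hτ h2
        obtain ⟨hτc, hτs⟩ := Equiv.Perm.mem_cycleFactorsFinset_iff.1 hτ
        refine aux_perm_walk G τ hτc ?_ ?_
        · intro y hy
          rw [hτs y hy]
          exact hadj y (Equiv.Perm.mem_cycleFactorsFinset_support_le hτ hy)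
        · have := hτc.two_le_card_support
          omega
      by_cases hall : ∀ τ ∈ σ.cycleFactorsFinset, τ.support.card = 2
      · rw [Finset.prod_eq_one]
        · simp
        · intro τ hτ
          rw [hall τ hτ, cycWeight_two]
      · push Not at hall
        obtain ⟨τ, hτ, hτ2⟩ := hall
        rw [Finset.prod_eq_single_of_mem τ hτ]
        · obtain ⟨u, w, hw, hwl, -⟩ := hcyc τ hτ hτ2
          rw [cycWeight_one_mod _ (by rw [← hwl, hlen u w hw, hk])]
          simp
        · intro ρ hρ hne
          by_cases hρ2 : ρ.support.card = 2
          · rw [hρ2, cycWeight_two]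
          · exfalso
            obtain ⟨u, w, hw, -, hws⟩ := hcyc τ hτ hτ2
            obtain ⟨u', w', hw', -, hws'⟩ := hcyc ρ hρ hρ2
            have hdis := (σ.cycleFactorsFinset_pairwise_disjoint hρ hτ hne).disjoint_support
            have hsub := aux_cycle_edges G hconn hedge w hw w' hw'
            have hmem := hsub (w.mk_start_snd_mem_edges hw.not_nil)
            exact Finset.disjoint_left.1 hdis
              (hws' _ (w'.fst_mem_support_of_mem_edges hmem)) (hws _ w.start_mem_support)
    · rw [aux_term_zero G x σ hadj]; simp
  · obtain ⟨τ, hτ, hcard, hadj⟩ := aux_walk_perm G c hc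
    refine ⟨τ, Finset.mem_univ _, ?_⟩
    rw [aux_term G x τ hadj, Complex.im_ofReal_mul, hτ.cycleFactorsFinset_eq_singleton,
      Finset.prod_singleton, cycWeight_one_mod _ (by rw [hcard, hk])]
    simp only [Complex.I_im, mul_one]
    positivity

theorem aux_det_prod [Fintype V] [DecidableEq V] (A : Matrix V V ℝ) (hA : A.IsHermitian) (x : ℝ) :
    ((x : ℂ) • (1 : Matrix V V ℂ) + Complex.I • A.map (algebraMap ℝ ℂ)).det
      = ∏ i, ((x : ℂ) + hA.eigenvalues i * Complex.I) := by
  have h := congrArg (fun p => (p.map (algebraMap ℝ ℂ)).eval (Complex.I * x)) hA.charpoly_eq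
  simp only [← Matrix.charpoly_map, Matrix.eval_charpoly] at h
  have e : ((x : ℂ) • (1 : Matrix V V ℂ) + Complex.I • A.map (algebraMap ℝ ℂ))
      = (-Complex.I) • (Matrix.scalar V (Complex.I * x) - A.map (algebraMap ℝ ℂ)) := by
    rw [smul_sub]
    ext i j
    by_cases hij : i = j
    · subst hij
      simp [← mul_assoc]
    · simp [hij]
  rw [e, Matrix.det_smul, h, Polynomial.eval_map, Polynomial.eval₂_finsetProd, Fintype.card,
    ← Finset.prod_const, ← Finset.prod_mul_distrib]
  refine Finset.prod_congr rfl fun i _ => ?_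
  simp
  linear_combination (-x : ℂ) * Complex.I_mul_I

theorem aux_sum_sq [Fintype V] [DecidableEq V] (A : Matrix V V ℝ) (hA : A.IsHermitian) :
    ∑ i, hA.eigenvalues i ^ 2 = (A * A).trace := by
  have h : A * A = _ := congrArg (fun M => M * M) hA.spectral_theorem
  rw [h, ← map_mul, Unitary.conjStarAlgAut_apply, Matrix.trace_mul_comm, ← mul_assoc]
  simp [Matrix.trace_diagonal, pow_two]

/-- A unicyclic graph whose unique cycle has length `k ≡ 1 (mod 4)` satisfies
`s⁺(G) < n < s⁻(G)`. -/
theorem unicyclic_one_mod_four [Fintype V] [DecidableEq V] (G : SimpleGraph V)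
    [DecidableRel G.Adj]
    (hconn : G.Connected) (hedge : G.edgeFinset.card = Fintype.card V)
    (v : V) (c : G.Walk v v) (hc : c.IsCycle) (hk : c.length % 4 = 1) :
    sPlus G < Fintype.card V ∧ (Fintype.card V : ℝ) < sMinus G := by
  have hmap : (G.adjMatrix ℝ).map (algebraMap ℝ ℂ) = G.adjMatrix ℂ := by
    ext i j
    by_cases h : G.Adj i j <;> simp [h]
  have hsum : ∑ i, (adjHerm G).eigenvalues i = 0 := by
    have := (adjHerm G).trace_eq_sum_eigenvalues
    rw [SimpleGraph.trace_adjMatrix] at this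
    simpa using this.symm
  have hsq : ∑ i, (adjHerm G).eigenvalues i ^ 2 = 2 * Fintype.card V := by
    rw [aux_sum_sq, Matrix.trace]
    simp only [Matrix.diag_apply, SimpleGraph.adjMatrix_mul_self_apply_self]
    rw [← hedge]
    exact_mod_cast G.sum_degrees_eq_twice_card_edges
  have hen := aux_energy (adjHerm G).eigenvalues hsum (by
    intro x hx
    rw [← aux_det_prod, hmap]
    exact aux_det_im G hconn hedge v c hc hk x hx)
  have e1 : sPlus G + sMinus G = ∑ i, (adjHerm G).eigenvalues i ^ 2 := by
    rw [sPlus, sMinus, ← Finset.sum_add_distrib]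
    refine Finset.sum_congr rfl fun i _ => ?_
    rcases lt_trichotomy ((adjHerm G).eigenvalues i) 0 with h | h | h
    · simp [h, h.le, not_lt.2 h.le]
    · simp [h]
    · simp [h, not_lt.2 h.le]
  have e2 : sPlus G - sMinus G
      = ∑ i, (adjHerm G).eigenvalues i * |(adjHerm G).eigenvalues i| := by
    rw [sPlus, sMinus, ← Finset.sum_sub_distrib]
    refine Finset.sum_congr rfl fun i _ => ?_
    rcases lt_trichotomy ((adjHerm G).eigenvalues i) 0 with h | h | h
    · rw [if_neg (not_lt.2 h.le), if_pos h, abs_of_neg h]; ring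
    · simp [h]
    · rw [if_pos h, if_neg (not_lt.2 h.le), abs_of_pos h]; ring
  constructor <;> linarith
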